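/- Let 1 → A →α B →β C → 1 be a central extension of Γ-groups and U a cover of a left Γ-set X. Suppose φ ∈ K^1_Γ(U,X,C) is a coboundary, i.e. φ = (δ_1φ̃)^{−1}(δ_0φ̃) for some φ̃ ∈ K^0_Γ(U,X,C), and suppose ψ̃ ∈ K^0_Γ(U,X,B) satisfies β ∘ ψ̃ = φ̃. Then ψ := (δ_1ψ̃)^{−1}(δ_0ψ̃) ∈ K^1_Γ(U,X,B) satisfies β ∘ ψ = φ and the 1-cocycle condition exactly: (δ_1ψ)^{−1}(δ_2ψ)(δ_0ψ) = 1. In particular the Dixmier–Douady class of a coboundary vanishes. -/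

import Mathlib

namespace SemiDD

/-- Extend a finite tuple by `1` outside its range. -/
def ext {G : Type*} [One G] {n : ℕ} (f : Fin n → G) (m : ℕ) : G :=
  if h : m < n then f ⟨m, h⟩ else 1

/-- The face maps `d_i : X^{p+1} → X^p` of the simplicial space `X^• = {Γ^p × X}`. -/
def face {Γ X : Type*} [Group Γ] [MulAction Γ X] {p : ℕ} (i : ℕ)
    (z : (Fin (p + 1) → Γ) × X) : (Fin p → Γ) × X :=
  (fun k => if (k : ℕ) + 1 < i then ext z.1 (k : ℕ)
    else if (k : ℕ) + 1 = i then ext z.1 (k : ℕ) * ext z.1 ((k : ℕ) + 1)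
    else ext z.1 ((k : ℕ) + 1),
   if i = p + 1 then ext z.1 p • z.2 else z.2)

/-- The degeneracy maps `e_i : X^p → X^{p+1}` of the simplicial space. -/
def degen {Γ X : Type*} [One Γ] {p : ℕ} (i : ℕ)
    (z : (Fin p → Γ) × X) : (Fin (p + 1) → Γ) × X :=
  (fun k => if (k : ℕ) < i then ext z.1 (k : ℕ)
    else if (k : ℕ) = i then 1
    else ext z.1 ((k : ℕ) - 1), z.2)

/-- The simplicial twisting maps `θ_i^{x^p} : G → G`: `θ_0^{(γ_1,…,γ_p,x)} = θ_{γ_1}`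
and `θ_i = id` for `i ≥ 1`. -/
def twist {Γ G : Type*} [Group Γ] [Group G] [MulDistribMulAction Γ G]
    {X : Type*} {p : ℕ} (i : ℕ) (z : (Fin p → Γ) × X) (g : G) : G :=
  if i = 0 then ext z.1 0 • g else g

/-- The point `x^p_i = γ_{i+1}⋯γ_p • x` associated to `x^p = (γ_1,…,γ_p,x) ∈ X^p`. -/
def pt {Γ X : Type*} [Group Γ] [MulAction Γ X] {p : ℕ}
    (z : (Fin p → Γ) × X) (i : ℕ) : X :=
  (((List.range p).drop i).map (ext z.1)).prod • z.2

/-- The subset `U_{(a_0,…,a_p)} ⊆ X^p` of the simplicial cover. -/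
def tupSet {Γ X ι : Type*} [Group Γ] [MulAction Γ X] (U : ι → Set X)
    {p : ℕ} (a : Fin (p + 1) → ι) : Set ((Fin p → Γ) × X) :=
  {z | ∀ i : Fin (p + 1), pt z (i : ℕ) ∈ U (a i)}

/-- The face map on index tuples: delete the `i`-th entry. -/
def faceIdx {ι : Type*} {n : ℕ} (i : ℕ) (a : Fin (n + 1) → ι) : Fin n → ι :=
  fun k => if (k : ℕ) < i then a k.castSucc else a k.succ

/-- The group `K^p_Γ(U,X,(G,θ))` of `p`-cochains. -/
abbrev K (Γ : Type*) {X ι : Type*} [Group Γ] [MulAction Γ X]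
    (U : ι → Set X) (G : Type*) [Group G] (p : ℕ) :=
  ∀ a : Fin (p + 1) → ι, tupSet (Γ := Γ) U a → G

open Classical in
/-- The twisted pullback maps `δ_i : K^p → K^{p+1}`. -/
noncomputable def tpb {Γ X ι G : Type*} [Group Γ] [MulAction Γ X] [Group G]
    [MulDistribMulAction Γ G] {U : ι → Set X} {p : ℕ} (i : ℕ)
    (φ : K Γ U G p) : K Γ U G (p + 1) :=
  fun a z =>
    twist i z.1
      (if h : face i z.1 ∈ tupSet (Γ := Γ) U (faceIdx i a) then
        φ (faceIdx i a) ⟨face i z.1, h⟩ else 1)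

/-- The coboundary `∂ = Σ_{i=0}^{p+1} (−1)^i δ_i : K^p → K^{p+1}` (written
multiplicatively, as an ordered product; for abelian coefficients this is the
alternating sum of the twisted pullbacks). -/
noncomputable def cob {Γ X ι G : Type*} [Group Γ] [MulAction Γ X] [Group G]
    [MulDistribMulAction Γ G] {U : ι → Set X} {p : ℕ}
    (φ : K Γ U G p) : K Γ U G (p + 1) :=
  ((List.range (p + 2)).map (fun i => tpb i φ ^ ((-1 : ℤ) ^ i))).prod

/-- The map on cochains induced by a map of coefficient groups. -/
def mapK {Γ X ι : Type*} [Group Γ] [MulAction Γ X] {U : ι → Set X}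
    {A B : Type*} [Group A] [Group B] (f : A → B) {p : ℕ}
    (φ : K Γ U A p) : K Γ U B p :=
  fun a z => f (φ a z)

/-- The restriction map on cochains induced by a refinement `r` of covers. -/
def res {Γ X ι κ G : Type*} [Group Γ] [MulAction Γ X] [Group G]
    {U : ι → Set X} {V : κ → Set X} (r : κ → ι)
    (hr : ∀ b, V b ⊆ U (r b)) {p : ℕ} (φ : K Γ U G p) : K Γ V G p :=
  fun b z => φ (fun i => r (b i)) ⟨z.1, fun i => hr (b i) (z.2 i)⟩

/-- A `Γ`-semi-equivariant (G,θ)-valued transition cocycle over the cover `U`. -/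
def IsCocycle {Γ X G ι : Type*} [Group Γ] [MulAction Γ X] [Group G]
    [MulDistribMulAction Γ G] (U : ι → Set X) (φ : ι → ι → Γ → X → G) : Prop :=
  (∀ (a : ι) (x : X), x ∈ U a → φ a a 1 x = 1) ∧
  (∀ (γ' γ : Γ) (a b c : ι) (x : X), x ∈ U a → γ • x ∈ U b →
    (γ' * γ) • x ∈ U c →
    φ c a (γ' * γ) x = φ c b γ' (γ • x) * γ' • φ b a γ x)

/-- Set-theoretic data of a `Γ`-semi-equivariant principal `(G,θ)`-bundle over
a left `Γ`-set `X`. -/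
structure SEBundle (Γ X G : Type*) [Group Γ] [MulAction Γ X] [Group G]
    [MulDistribMulAction Γ G] where
  P : Type*
  π : P → X
  surj : Function.Surjective π
  actG : P → G → P
  actG_one : ∀ p, actG p 1 = p
  actG_mul : ∀ p g g', actG (actG p g) g' = actG p (g * g')
  π_actG : ∀ p g, π (actG p g) = π p
  freeTrans : ∀ p q, π p = π q → ∃! g, actG p g = q
  actΓ : Γ → P → P
  actΓ_one : ∀ p, actΓ 1 p = p
  actΓ_mul : ∀ γ' γ p, actΓ γ' (actΓ γ p) = actΓ (γ' * γ) p
  π_actΓ : ∀ γ p, π (actΓ γ p) = γ • π p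
  semi : ∀ γ p g, actΓ γ (actG p g) = actG (actΓ γ p) (γ • g)

/-- The total space `⨆_{a} {a} × U_a × G` used in reconstructing a bundle
from a transition cocycle. -/
def Tot {X ι : Type*} (U : ι → Set X) (G : Type*) :=
  Σ a : ι, (U a) × G

/-- The gluing relation `(a,x,g) ~ (b,x,φ_{ba}(1,x)·g)`. -/
def rel {Γ X G ι : Type*} [One Γ] [Mul G] (U : ι → Set X)
    (φ : ι → ι → Γ → X → G) (z w : Tot U G) : Prop :=
  (z.2.1 : X) = (w.2.1 : X) ∧ w.2.2 = φ w.1 z.1 (1 : Γ) (z.2.1 : X) * z.2.2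

/-- The total space `P^φ` of the bundle reconstructed from a transition
cocycle `φ`. -/
def PB {Γ X G ι : Type*} [One Γ] [Mul G] (U : ι → Set X)
    (φ : ι → ι → Γ → X → G) :=
  Quot (rel U φ)

/-- The projection `π : P^φ → X`, `[a,x,g] ↦ x`. -/
def pbProj {Γ X G ι : Type*} [One Γ] [Mul G] {U : ι → Set X}
    {φ : ι → ι → Γ → X → G} : PB U φ → X :=
  Quot.lift (fun z => (z.2.1 : X)) (fun _ _ h => h.1)

/-- The right `G`-action on `P^φ`, `[a,x,g]·g' = [a,x,g·g']`. -/
def pbActG {Γ X G ι : Type*} [One Γ] [Group G] {U : ι → Set X}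
    {φ : ι → ι → Γ → X → G} (g' : G) : PB U φ → PB U φ :=
  Quot.lift (fun z => Quot.mk (rel U φ) ⟨z.1, ⟨z.2.1, z.2.2 * g'⟩⟩)
    (fun z w h => Quot.sound
      ⟨h.1, show w.2.2 * g' = φ w.1 z.1 (1 : Γ) (z.2.1 : X) * (z.2.2 * g') from
        by rw [h.2, mul_assoc]⟩)

/-- Specification of the left `Γ`-action `γ·[a,x,g] = [b, γ·x, φ_{ba}(γ,x)·(γ·g)]`
on `P^φ`. -/
def pbActSpec {Γ X G ι : Type*} [Group Γ] [MulAction Γ X] [Group G]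
    [MulDistribMulAction Γ G] (U : ι → Set X) (φ : ι → ι → Γ → X → G)
    (act : Γ → PB U φ → PB U φ) : Prop :=
  ∀ (γ : Γ) (a : ι) (x : X) (hx : x ∈ U a) (g : G) (b : ι) (hb : γ • x ∈ U b),
    act γ (Quot.mk (rel U φ) ⟨a, ⟨⟨x, hx⟩, g⟩⟩) =
      Quot.mk (rel U φ) ⟨b, ⟨⟨γ • x, hb⟩, φ b a γ x * γ • g⟩⟩

theorem face_mem_tupSet_one {Γ X ι : Type*} [Group Γ] [MulAction Γ X] {U : ι → Set X}
    {a : Fin 2 → ι} {z : (Fin 1 → Γ) × X} (hz : z ∈ tupSet (Γ := Γ) U a) {i : ℕ} (hi : i ≤ 1) :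
    face i z ∈ tupSet (Γ := Γ) U (faceIdx i a) := by
  have h0 := hz 0
  have h1 := hz 1
  intro k
  fin_cases k
  interval_cases i <;>
    simp_all [pt, face, faceIdx, ext, List.range_succ]

theorem face_mem_tupSet_two {Γ X ι : Type*} [Group Γ] [MulAction Γ X] {U : ι → Set X}
    {a : Fin 3 → ι} {z : (Fin 2 → Γ) × X} (hz : z ∈ tupSet (Γ := Γ) U a) {i : ℕ} (hi : i ≤ 2) :
    face i z ∈ tupSet (Γ := Γ) U (faceIdx i a) := by
  have h0 := hz 0
  have h1 := hz 1
  have h2 := hz 2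
  intro k
  interval_cases i <;> fin_cases k <;>
    simp_all [pt, face, faceIdx, ext, List.range_succ, mul_smul]

theorem tpb_apply {Γ X ι G : Type*} [Group Γ] [MulAction Γ X] [Group G]
    [MulDistribMulAction Γ G] {U : ι → Set X} {p i : ℕ} (φ : K Γ U G p)
    {a : Fin (p + 2) → ι} (z : tupSet (Γ := Γ) U a)
    (h : face i z.1 ∈ tupSet (Γ := Γ) U (faceIdx i a)) :
    tpb i φ a z = twist i z.1 (φ (faceIdx i a) ⟨face i z.1, h⟩) := by
  simp only [tpb, dif_pos h]

theorem tpb_mul {Γ X ι G : Type*} [Group Γ] [MulAction Γ X] [Group G]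
    [MulDistribMulAction Γ G] {U : ι → Set X} {p : ℕ} (i : ℕ) (φ χ : K Γ U G p) :
    tpb i (φ * χ) = tpb i φ * tpb i χ := by
  funext a z
  simp only [tpb, twist, Pi.mul_apply]
  split_ifs <;> simp

theorem tpb_inv {Γ X ι G : Type*} [Group Γ] [MulAction Γ X] [Group G]
    [MulDistribMulAction Γ G] {U : ι → Set X} {p : ℕ} (i : ℕ) (φ : K Γ U G p) :
    tpb i φ⁻¹ = (tpb i φ)⁻¹ := by
  funext a z
  simp only [tpb, twist, Pi.inv_apply]
  split_ifs <;> simp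

theorem mapK_tpb {Γ X ι B C : Type*} [Group Γ] [MulAction Γ X] [Group B] [Group C]
    [MulDistribMulAction Γ B] [MulDistribMulAction Γ C] {U : ι → Set X} (β : B →* C)
    (hβΓ : ∀ (γ : Γ) (g : B), β (γ • g) = γ • β g) {p : ℕ} (i : ℕ) (φ : K Γ U B p) :
    mapK β (tpb i φ) = tpb i (mapK β φ) := by
  funext a z
  simp only [tpb, twist, mapK]
  split_ifs <;> simp [hβΓ]

theorem K_congr {Γ X ι G : Type*} [Group Γ] [MulAction Γ X] [Group G] {U : ι → Set X} {p : ℕ}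
    (φ : K Γ U G p) {a b : Fin (p + 1) → ι} (hab : a = b) {z : tupSet (Γ := Γ) U a}
    {w : tupSet (Γ := Γ) U b} (hzw : z.1 = w.1) : φ a z = φ b w := by
  subst hab
  rw [Subtype.ext hzw]

/-- The simplicial identities `δ_j δ_i = δ_i δ_{j-1}` for `i < j` on `0`-cochains. -/
theorem tpb_tpb {Γ X ι G : Type*} [Group Γ] [MulAction Γ X] [Group G]
    [MulDistribMulAction Γ G] {U : ι → Set X} (φ : K Γ U G 0) {i j : ℕ} (hij : i ≤ j)
    (hj : j ≤ 1) : tpb (j + 1) (tpb i φ) = tpb i (tpb j φ) := by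
  funext a z
  have hi1 := face_mem_tupSet_two z.2 (show i ≤ 2 by lia)
  have hj1 := face_mem_tupSet_two z.2 (show j + 1 ≤ 2 by lia)
  rw [tpb_apply _ z hi1, tpb_apply _ z hj1,
    tpb_apply _ ⟨_, hi1⟩ (face_mem_tupSet_one hi1 hj),
    tpb_apply _ ⟨_, hj1⟩ (face_mem_tupSet_one hj1 (hij.trans hj))]
  have hφ : φ (faceIdx i (faceIdx (j + 1) a)) ⟨_, face_mem_tupSet_one hj1 (hij.trans hj)⟩ =
      φ (faceIdx j (faceIdx i a)) ⟨_, face_mem_tupSet_one hi1 hj⟩ := by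
    refine K_congr φ ?_ ?_
    · funext k
      fin_cases k
      interval_cases j <;> interval_cases i <;> simp [faceIdx]
    · refine Prod.ext (Subsingleton.elim _ _) ?_
      interval_cases j <;> interval_cases i <;> simp [face, ext, mul_smul]
  rw [hφ]
  interval_cases j <;> interval_cases i <;> simp [twist, face, ext, mul_smul]

/-- if `φ` is a 1-coboundary, `φ = (δ₁φ̃)⁻¹(δ₀φ̃)`, and `ψ̃`
lifts `φ̃`, then `ψ = (δ₁ψ̃)⁻¹(δ₀ψ̃)` lifts `φ` and satisfies the 1-cocycle
condition exactly; in particular the Dixmier–Douady class of a coboundary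
vanishes. -/
theorem statement17 {Γ X ι A B C : Type*} [Group Γ] [MulAction Γ X]
    [CommGroup A] [Group B] [Group C] [MulDistribMulAction Γ A]
    [MulDistribMulAction Γ B] [MulDistribMulAction Γ C]
    (U : ι → Set X) (α : A →* B) (β : B →* C)
    (hαΓ : ∀ (γ : Γ) (g : A), α (γ • g) = γ • α g)
    (hβΓ : ∀ (γ : Γ) (g : B), β (γ • g) = γ • β g)
    (hαinj : Function.Injective ⇑α)
    (hcentral : ∀ (x : A) (b : B), α x * b = b * α x)
    (hβsurj : Function.Surjective ⇑β)
    (hexact : ∀ b : B, β b = 1 ↔ b ∈ Set.range ⇑α)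
    (φt : K Γ U C 0) (φ : K Γ U C 1) (hφ : φ = (tpb 1 φt)⁻¹ * tpb 0 φt)
    (ψt : K Γ U B 0) (hψt : mapK (⇑β) ψt = φt)
    (ψ : K Γ U B 1) (hψdef : ψ = (tpb 1 ψt)⁻¹ * tpb 0 ψt) :
    mapK (⇑β) ψ = φ ∧ (tpb 1 ψ)⁻¹ * tpb 2 ψ * tpb 0 ψ = 1 := by
  subst hφ hψt hψdef
  constructor
  · rw [← mapK_tpb β hβΓ, ← mapK_tpb β hβΓ]
    funext a z
    simp [mapK]
  · simp only [tpb_mul, tpb_inv]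
    rw [tpb_tpb ψt (le_refl 1) le_rfl, tpb_tpb ψt (le_refl 0) zero_le_one,
      tpb_tpb ψt zero_le_one le_rfl]
    group

end SemiDD
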